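/- Let α ∈ (0,∞). Let F be a map assigning to every measure-preserving function f : (X,p) → (Y,q) between finite probability spaces a number F(f) ∈ [0,∞). Suppose F satisfies: (1) Functoriality: F(f ∘ g) = F(f) + F(g) for composable f, g; (2) Compatibility with convex combinations: F(λf ⊕ (1−λ)g) = λ^α F(f) + (1−λ)^α F(g) for all measure-preserving f, g and all λ ∈ [0,1]; (3) Continuity: F(f_n) → F(f) whenever f_n converges to f. Then there exists a constant c ≥ 0 such that F(f) = c(H_α(p) − H_α(q)) for every measure-preserving f : (X,p) → (Y,q), where H_α is the Tsallis entropy of order α. -/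

import Mathlib

open scoped BigOperators Classical
open Filter Topology Real

/-- `p` is a probability measure on the finite set `X`. -/
def IsProb {X : Type} [Fintype X] (p : X → ℝ) : Prop :=
  (∀ i, 0 ≤ p i) ∧ ∑ i, p i = 1

/-- `p` is a (nonnegative) measure on the finite set `X`. -/
def IsMeas {X : Type} [Fintype X] (p : X → ℝ) : Prop :=
  ∀ i, 0 ≤ p i

/-- `f` is a measure-preserving function from `(X, p)` to `(Y, q)`. -/
def IsMP {X Y : Type} [Fintype X] [Fintype Y] (p : X → ℝ) (q : Y → ℝ) (f : X → Y) : Prop :=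
  ∀ j : Y, q j = ∑ i, if f i = j then p i else 0

/-- Shannon entropy (with the convention `0 * log 0 = 0`, automatic since `Real.log 0 = 0`). -/
noncomputable def shannon {X : Type} [Fintype X] (p : X → ℝ) : ℝ :=
  -∑ i, p i * Real.log (p i)

/-- The convex combination `λ p ⊕ (1 - λ) q` on the disjoint union. -/
noncomputable def cvx (lam : ℝ) {X Y : Type} (p : X → ℝ) (q : Y → ℝ) : X ⊕ Y → ℝ :=
  Sum.elim (fun i => lam * p i) (fun j => (1 - lam) * q j)

/-- The direct sum `p ⊕ q` on the disjoint union. -/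
def dsum {X Y : Type} (p : X → ℝ) (q : Y → ℝ) : X ⊕ Y → ℝ :=
  Sum.elim p q

/-- Extended Shannon entropy of a measure on a finite set. -/
noncomputable def shannonExt {X : Type} [Fintype X] (p : X → ℝ) : ℝ :=
  if (∑ i, p i) = 0 then 0 else (∑ i, p i) * shannon (fun i => p i / ∑ j, p j)

/-- Tsallis entropy of order `α` of a probability measure. -/
noncomputable def tsallis (α : ℝ) {X : Type} [Fintype X] (p : X → ℝ) : ℝ :=
  if α = 1 then shannon p else (1 / (α - 1)) * (1 - ∑ i, p i ^ α)

/-- Extended Tsallis entropy of order `α` of a measure on a finite set. -/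
noncomputable def tsallisExt (α : ℝ) {X : Type} [Fintype X] (p : X → ℝ) : ℝ :=
  if (∑ i, p i) = 0 then 0 else (∑ i, p i) ^ α * tsallis α (fun i => p i / ∑ j, p j)

/-- The map to a point-preserving structure is invariant: any prob on `A ⊕ Unit` is a combination. -/
lemma exists_cvx {A : Type} [Fintype A] [Nonempty A] (r : A ⊕ Unit → ℝ) (hr : IsProb r) :
    ∃ (lam : ℝ) (q : A → ℝ), 0 ≤ lam ∧ lam ≤ 1 ∧ IsProb q ∧
      r = cvx lam q (fun _ : Unit => (1 : ℝ)) := by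
  obtain ⟨h0, h1⟩ := hr
  rw [Fintype.sum_sum_type] at h1
  simp only [Finset.univ_unique, Finset.sum_singleton] at h1
  have hnn : 0 ≤ ∑ a, r (Sum.inl a) := Finset.sum_nonneg fun a _ => h0 _
  have hu : r (Sum.inr ()) = 1 - ∑ a, r (Sum.inl a) := by
    have : r (Sum.inr default) = r (Sum.inr ()) := rfl
    linarith
  have hle : ∑ a, r (Sum.inl a) ≤ 1 := by linarith [h0 (Sum.inr ())]
  by_cases hz : ∑ a, r (Sum.inl a) = 0
  · obtain ⟨a0⟩ := ‹Nonempty A›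
    refine ⟨0, fun a => if a = a0 then 1 else 0, le_rfl, zero_le_one, ⟨?_, ?_⟩, ?_⟩
    · intro i; dsimp only; split_ifs <;> norm_num
    · simp
    · rw [Finset.sum_eq_zero_iff_of_nonneg (fun a _ => h0 _)] at hz
      funext x
      rcases x with a | u
      · simp [cvx, hz a (Finset.mem_univ a)]
      · simp [cvx, hu]
        exact Finset.sum_eq_zero hz
  · refine ⟨∑ a, r (Sum.inl a), fun a => r (Sum.inl a) / ∑ a, r (Sum.inl a), hnn, hle,
      ⟨fun i => div_nonneg (h0 _) hnn, ?_⟩, ?_⟩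
    · rw [← Finset.sum_div, div_self hz]
    · funext x
      rcases x with a | u
      · simp only [cvx, Sum.elim_inl]; field_simp
      · simp [cvx, hu]

lemma isProb_unit : IsProb (fun _ : Unit => (1 : ℝ)) := ⟨fun _ => zero_le_one, by simp⟩

lemma isProb_comp {X Y : Type} [Fintype X] [Fintype Y] (e : X ≃ Y) {p : Y → ℝ} (hp : IsProb p) :
    IsProb (p ∘ e) :=
  ⟨fun i => hp.1 _, by rw [← hp.2]; exact e.sum_comp p⟩

lemma isProb_cvx {X Y : Type} [Fintype X] [Fintype Y] {lam : ℝ} (h0 : 0 ≤ lam) (h1 : lam ≤ 1)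
    {p : X → ℝ} {q : Y → ℝ} (hp : IsProb p) (hq : IsProb q) : IsProb (cvx lam p q) := by
  refine ⟨?_, ?_⟩
  · rintro (i | j)
    · exact mul_nonneg h0 (hp.1 i)
    · exact mul_nonneg (by linarith) (hq.1 j)
  · rw [Fintype.sum_sum_type]
    simp only [cvx, Sum.elim_inl, Sum.elim_inr, ← Finset.mul_sum, hp.2, hq.2]
    ring

lemma prob_induction (P : ∀ {X : Type} [Fintype X], (X → ℝ) → Prop)
    (hunit : P (fun _ : Unit => (1 : ℝ)))
    (hequiv : ∀ {X Y : Type} [Fintype X] [Fintype Y] (e : X ≃ Y) (p : Y → ℝ), IsProb p →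
      P p → P (p ∘ e))
    (hc : ∀ {X Y : Type} [Fintype X] [Fintype Y] (p : X → ℝ) (q : Y → ℝ) (lam : ℝ),
      0 ≤ lam → lam ≤ 1 → IsProb p → IsProb q → P p → P q → P (cvx lam p q))
    {X : Type} [Fintype X] (p : X → ℝ) (hp : IsProb p) : P p := by
  have key : ∀ n : ℕ, ∀ p : Fin n → ℝ, IsProb p → P p := by
    intro n
    induction n with
    | zero => intro p hp; have := hp.2; simp at this
    | succ n ih =>
      intro p hp
      let e : Fin (n + 1) ≃ Fin n ⊕ Unit :=
        (finSuccEquiv n).trans (Equiv.optionEquivSumPUnit (Fin n))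
      have hpe : IsProb (p ∘ e.symm) := isProb_comp e.symm hp
      have hpp : p = (p ∘ e.symm) ∘ e := by funext i; simp
      rw [hpp]
      rcases Nat.eq_zero_or_pos n with rfl | hn
      · let e' : Fin 1 ≃ Unit := Equiv.ofUnique _ _
        have : (p ∘ e.symm) ∘ e = (fun _ : Unit => (1 : ℝ)) ∘ e' := by
          funext i
          have := hp.2
          simp at this
          fin_cases i
          simp [this]
        rw [this]
        exact hequiv e' _ isProb_unit hunit
      · have : Nonempty (Fin n) := ⟨⟨0, hn⟩⟩
        apply hequiv e _ hpe
        obtain ⟨lam, q, h0, h1, hq, h⟩ := exists_cvx _ hpe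
        rw [h]
        exact hc q _ lam h0 h1 hq isProb_unit (ih q hq) hunit
  have hpp : p = (p ∘ (Fintype.equivFin X).symm) ∘ (Fintype.equivFin X) := by funext i; simp
  have hpe := isProb_comp (Fintype.equivFin X).symm hp
  rw [hpp]
  exact hequiv _ _ hpe (key _ _ hpe)

/-- Product measure. -/
def prodM {X Y : Type} (p : X → ℝ) (q : Y → ℝ) : X × Y → ℝ := fun z => p z.1 * q z.2

lemma isProb_prodM {X Y : Type} [Fintype X] [Fintype Y] {p : X → ℝ} {q : Y → ℝ}
    (hp : IsProb p) (hq : IsProb q) : IsProb (prodM p q) := by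
  refine ⟨fun z => mul_nonneg (hp.1 _) (hq.1 _), ?_⟩
  rw [Fintype.sum_prod_type]
  simp only [prodM, ← Finset.mul_sum, hq.2, mul_one, hp.2]

/-- Completely additive sequence with vanishing differences. -/
lemma additive_log (L : ℕ → ℝ) (hmul : ∀ m n, 0 < m → 0 < n → L (m * n) = L m + L n)
    (hd : Tendsto (fun n => L (n + 1) - L n) atTop (𝓝 0)) :
    ∀ n, 0 < n → L n = L 2 / Real.log 2 * Real.log n := by
  have hl2 : 0 < Real.log 2 := Real.log_pos (by norm_num)
  set c := L 2 / Real.log 2 with hc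
  set f : ℕ → ℝ := fun n => L n - c * Real.log n with hf
  have fmul : ∀ m n, 0 < m → 0 < n → f (m * n) = f m + f n := by
    intro m n hm hn
    simp only [hf]
    rw [hmul m n hm hn]
    push_cast
    rw [Real.log_mul (by positivity) (by positivity)]
    ring
  have f2 : f 2 = 0 := by
    simp only [hf, hc]; push_cast; field_simp; ring
  have fd : Tendsto (fun n => f (n + 1) - f n) atTop (𝓝 0) := by
    have h1 : Tendsto (fun n : ℕ => Real.log ((n : ℝ) + 1) - Real.log n) atTop (𝓝 0) := by
      exact (Real.tendsto_log_comp_add_sub_log 1).comp tendsto_natCast_atTop_atTop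
    have := hd.sub (h1.const_mul c)
    simp only [mul_zero, sub_zero] at this
    refine this.congr fun n => ?_
    simp only [hf]; push_cast; ring
  have fpow : ∀ a k : ℕ, 0 < a → f (a ^ k) = k * f a := by
    intro a k ha
    induction k with
    | zero => 
      have := fmul 1 1 one_pos one_pos
      simp at this
      simp [this]
    | succ k ih => rw [pow_succ, fmul _ _ (pow_pos ha k) ha, ih]; push_cast; ring
  have bound : ∀ ε > 0, ∃ M : ℝ, ∀ n, 0 < n → |f n| ≤ M + ε * (Nat.log 2 n : ℝ) := by
    intro ε hε
    obtain ⟨K, hK⟩ := (Metric.tendsto_atTop.1 fd) ε hε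
    refine ⟨∑ i ∈ Finset.range (2 * K + 2), |f i|, ?_⟩
    intro n
    induction n using Nat.strong_induction_on with
    | _ n ih =>
      intro hn
      by_cases hnK : n < 2 * K + 2
      · have := Finset.single_le_sum (f := fun i => |f i|) (fun i _ => abs_nonneg _)
          (Finset.mem_range.2 hnK)
        have h2 : 0 ≤ ε * (Nat.log 2 n : ℝ) := by positivity
        linarith
      · have hlog : (Nat.log 2 n : ℝ) = (Nat.log 2 (n / 2) : ℝ) + 1 := by
          rw [Nat.log_of_one_lt_of_le (by norm_num) (by omega)]; push_cast; ring
        have h1 := ih (n / 2) (by omega) (by omega)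
        have h2 : |f n - f (n / 2)| ≤ ε := by
          rcases Nat.even_or_odd' n with ⟨m, hm | hm⟩
          · have : n / 2 = m := by omega
            rw [this, hm, fmul 2 m (by norm_num) (by omega), f2]
            simp [hε.le]
          · have : n / 2 = m := by omega
            have h3 := hK (2 * m) (by omega)
            rw [Real.dist_eq, sub_zero, fmul 2 m (by norm_num) (by omega), f2, zero_add] at h3
            rw [this, hm]
            exact h3.le
        have h3 := abs_sub_abs_le_abs_sub (f n) (f (n / 2))
        rw [hlog]
        linarith
  intro a ha
  have hfa : |f a| ≤ 0 := by
    have step : ∀ ε > 0, |f a| ≤ ε * a := by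
      intro ε hε
      obtain ⟨M, hM⟩ := bound ε hε
      by_contra hlt
      push Not at hlt
      obtain ⟨k, hk⟩ := exists_nat_gt (M / (|f a| - ε * a))
      rw [div_lt_iff₀ (by linarith)] at hk
      have h1 := hM (a ^ k) (pow_pos ha k)
      rw [fpow a k ha, abs_mul, Nat.abs_cast] at h1
      have h2 : Nat.log 2 (a ^ k) ≤ a * k := by
        have : a ^ k ≤ 2 ^ (a * k) := by
          rw [pow_mul]; exact Nat.pow_le_pow_left Nat.lt_two_pow_self.le k
        calc Nat.log 2 (a ^ k) ≤ Nat.log 2 (2 ^ (a * k)) := Nat.log_mono_right this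
          _ = _ := Nat.log_pow (by norm_num) _
      have h3 : (Nat.log 2 (a ^ k) : ℝ) ≤ a * k := by exact_mod_cast h2
      have h4 := mul_le_mul_of_nonneg_left h3 hε.le
      nlinarith
    apply le_of_forall_pos_le_add
    intro δ hδ
    have hapos : (0 : ℝ) < a := by exact_mod_cast ha
    have := step (δ / a) (by positivity)
    rwa [div_mul_cancel₀ _ hapos.ne', ← zero_add δ] at this
  have := abs_nonpos_iff.1 hfa
  simp only [hf] at this
  linarith

/-- Entropy-like functionals are multiples of Tsallis entropy. -/
theorem entropy_char (α : ℝ) (hα : 0 < α)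
    (I : ∀ {X : Type} [Fintype X], (X → ℝ) → ℝ)
    (hnn : ∀ {X : Type} [Fintype X] (p : X → ℝ), IsProb p → 0 ≤ I p)
    (hinv : ∀ {X Y : Type} [Fintype X] [Fintype Y] (e : X ≃ Y) (p : Y → ℝ), IsProb p →
      I (p ∘ e) = I p)
    (hunit : I (fun _ : Unit => (1 : ℝ)) = 0)
    (hcv : ∀ {X Y : Type} [Fintype X] [Fintype Y] (p : X → ℝ) (q : Y → ℝ) (lam : ℝ),
      0 ≤ lam → lam ≤ 1 → IsProb p → IsProb q →
      I (cvx lam p q) = I (cvx lam (fun _ : Unit => (1 : ℝ)) (fun _ : Unit => (1 : ℝ)))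
        + lam ^ α * I p + (1 - lam) ^ α * I q)
    (hcont : ∀ (x : ℕ → ℝ) (y : ℝ), (∀ n, 0 ≤ x n) → (∀ n, x n ≤ 1) → 0 ≤ y → y ≤ 1 →
      Tendsto x atTop (𝓝 y) →
      Tendsto (fun n => I (cvx (x n) (fun _ : Unit => (1 : ℝ)) (fun _ : Unit => (1 : ℝ))))
        atTop (𝓝 (I (cvx y (fun _ : Unit => (1 : ℝ)) (fun _ : Unit => (1 : ℝ)))))) :
    ∃ c : ℝ, 0 ≤ c ∧ ∀ {X : Type} [Fintype X] (p : X → ℝ), IsProb p → I p = c * tsallis α p := by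
  set u : Unit → ℝ := fun _ => 1 with hu
  have pu : IsProb u := isProb_unit
  set φ : ℝ → ℝ := fun x => I (cvx x u u) with hφ
  have hcv' : ∀ {X Y : Type} [Fintype X] [Fintype Y] (p : X → ℝ) (q : Y → ℝ) (lam : ℝ),
      0 ≤ lam → lam ≤ 1 → IsProb p → IsProb q →
      I (cvx lam p q) = φ lam + lam ^ α * I p + (1 - lam) ^ α * I q := hcv
  have z : (0 : ℝ) ^ α = 0 := Real.zero_rpow hα.ne'
  have φ1 : φ 1 = 0 := by
    have p1 : IsProb (cvx 1 u u) := isProb_cvx zero_le_one le_rfl pu pu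
    have h1 := hcv' (cvx 1 u u) u 1 zero_le_one le_rfl p1 pu
    have h2 := hcv' u (cvx 1 u u) 1 zero_le_one le_rfl pu p1
    have h3 := hinv (Equiv.sumAssoc Unit Unit Unit) (cvx 1 u (cvx 1 u u))
      (isProb_cvx zero_le_one le_rfl pu p1)
    have h4 : cvx 1 u (cvx 1 u u) ∘ (Equiv.sumAssoc Unit Unit Unit) = cvx 1 (cvx 1 u u) u := by
      funext x
      rcases x with (x | x) | x <;> simp [cvx]
    rw [h4, h1, h2] at h3
    have h5 : I (cvx 1 u u) = φ 1 := rfl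
    rw [h5] at h3
    simp [z, hunit] at h3
    exact h3
  have φ0 : φ 0 = 0 := by
    have h3 := hinv (Equiv.sumComm Unit Unit) (cvx 1 u u) (isProb_cvx zero_le_one le_rfl pu pu)
    have h4 : cvx 1 u u ∘ (Equiv.sumComm Unit Unit) = cvx 0 u u := by
      funext x
      rcases x with x | x <;> simp [cvx]
    rw [h4] at h3
    exact h3.trans φ1
  have S_cvx : ∀ {X Y : Type} [Fintype X] [Fintype Y] (p : X → ℝ) (q : Y → ℝ) (lam : ℝ),
      0 ≤ lam → lam ≤ 1 → IsProb p → IsProb q →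
      ∑ i, (cvx lam p q i) ^ α = lam ^ α * ∑ i, p i ^ α + (1 - lam) ^ α * ∑ i, q i ^ α := by
    intro X Y _ _ p q lam h0 h1 hp hq
    rw [Fintype.sum_sum_type, Finset.mul_sum, Finset.mul_sum]
    congr 1
    · exact Finset.sum_congr rfl fun i _ => Real.mul_rpow h0 (hp.1 i)
    · exact Finset.sum_congr rfl fun i _ => Real.mul_rpow (by linarith) (hq.1 i)
  have hprod : ∀ {Y : Type} [Fintype Y] (q : Y → ℝ), IsProb q →
      ∀ {X : Type} [Fintype X] (p : X → ℝ), IsProb p →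
      I (prodM p q) = I p + (∑ i, p i ^ α) * I q := by
    intro Y _ q hq X _ p hp
    refine prob_induction (fun {X} _ p => I (prodM p q) = I p + (∑ i, p i ^ α) * I q)
      ?_ ?_ ?_ p hp
    · have h := hinv (Equiv.punitProd Y) q hq
      have h2 : q ∘ (Equiv.punitProd Y) = prodM u q := by
        funext x; simp [prodM, hu]
      have h3 : I u = 0 := hunit
      change I (prodM u q) = I u + (∑ i, u i ^ α) * I q
      rw [← h2, h, h3]
      simp [hu]
    · intro X Z _ _ e p hp h
      change I (prodM (p ∘ e) q) = I (p ∘ e) + (∑ i, (p (e i)) ^ α) * I q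
      rw [hinv e p hp, e.sum_comp (fun i => p i ^ α), ← h,
        ← hinv (e.prodCongr (Equiv.refl Y)) (prodM p q) (isProb_prodM hp hq)]
      rfl
    · intro X Z _ _ p p' lam h0 h1 hp hp' h h'
      have e1 : prodM (cvx lam p p') q = cvx lam (prodM p q) (prodM p' q) ∘
          (Equiv.sumProdDistrib X Z Y) := by
        funext x
        rcases x with ⟨x | x, y⟩ <;> simp [cvx, prodM, mul_assoc]
      rw [e1, hinv _ _ (isProb_cvx h0 h1 (isProb_prodM hp hq) (isProb_prodM hp' hq)),
        hcv' _ _ lam h0 h1 (isProb_prodM hp hq) (isProb_prodM hp' hq),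
        hcv' _ _ lam h0 h1 hp hp', S_cvx _ _ _ h0 h1 hp hp', h, h']
      ring
  by_cases h1 : α = 1
  · subst h1
    simp only [Real.rpow_one] at *
    -- uniform measures
    set U : (n : ℕ) → Fin n → ℝ := fun n _ => 1 / (n : ℝ) with hU
    have pU : ∀ n, 0 < n → IsProb (U n) := by
      intro n hn
      have : (0 : ℝ) < n := by exact_mod_cast hn
      refine ⟨fun _ => by simp only [hU]; positivity, ?_⟩
      simp [hU]; field_simp
    set L : ℕ → ℝ := fun n => I (U n) with hL
    have L1 : L 1 = 0 := by
      rw [← hunit, ← hinv (Equiv.ofUnique (Fin 1) Unit) u pu]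
      simp only [hL]; congr 1
      funext i; simp [hU, hu]
    have Lmul : ∀ m n, 0 < m → 0 < n → L (m * n) = L m + L n := by
      intro m n hm hn
      have h := hprod (U n) (pU n hn) (U m) (pU m hm)
      rw [(pU m hm).2, one_mul] at h
      rw [← hinv (finProdFinEquiv.symm) _ (isProb_prodM (pU m hm) (pU n hn))] at h
      simp only [hL]
      rw [← h]; congr 1
      funext i; simp [hU, prodM, mul_comm]
    have Lsplit : ∀ m k, 0 < m → 0 < k → L (m + k) = φ ((m : ℝ) / (m + k : ℕ))
        + (m : ℝ) / (m + k : ℕ) * L m + (k : ℝ) / (m + k : ℕ) * L k := by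
      intro m k hm hk
      have hm' : (0 : ℝ) < m := by exact_mod_cast hm
      have hk' : (0 : ℝ) < k := by exact_mod_cast hk
      have e1 : 1 - (m : ℝ) / (m + k : ℕ) = (k : ℝ) / (m + k : ℕ) := by
        push_cast; field_simp; ring
      have h0 : 0 ≤ (m : ℝ) / (m + k : ℕ) := by positivity
      have h0' : 0 ≤ (k : ℝ) / (m + k : ℕ) := by positivity
      have h := hcv' (U m) (U k) ((m : ℝ) / (m + k : ℕ)) h0 (by linarith) (pU m hm) (pU k hk)
      rw [e1, ← hinv finSumFinEquiv.symm _ (isProb_cvx h0 (by linarith) (pU m hm) (pU k hk))] at h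
      simp only [hL]
      rw [← h]; congr 1
      funext i
      obtain ⟨j, rfl⟩ := finSumFinEquiv.surjective i
      simp only [Function.comp, Equiv.symm_apply_apply]
      rcases j with j | j
      · simp only [cvx, Sum.elim_inl, hU]; push_cast; field_simp
      · simp only [cvx, Sum.elim_inr, e1, hU]; push_cast; field_simp
    have hδ : Tendsto (fun n : ℕ => φ (1 - 1 / ((n : ℝ) + 1))) atTop (𝓝 0) := by
      rw [← φ1]
      refine hcont _ 1 ?_ ?_ zero_le_one le_rfl ?_
      · intro n
        have : (1 : ℝ) / (n + 1) ≤ 1 := by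
          rw [div_le_one (by positivity)]; linarith [(Nat.cast_nonneg n : (0 : ℝ) ≤ n)]
        linarith
      · intro n
        have : (0 : ℝ) ≤ 1 / (n + 1) := by positivity
        linarith
      · simpa using (tendsto_one_div_add_atTop_nhds_zero_nat (𝕜 := ℝ)).const_sub 1
    have Lrec : ∀ n : ℕ, 0 < n → ((n : ℝ) + 1) * L (n + 1)
        = (n + 1) * φ (1 - 1 / ((n : ℝ) + 1)) + n * L n := by
      intro n hn
      have h := Lsplit n 1 hn one_pos
      rw [L1] at h
      have e : (n : ℝ) / (n + 1 : ℕ) = 1 - 1 / ((n : ℝ) + 1) := by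
        push_cast; field_simp; ring
      rw [h, e]; field_simp; ring
    have Lsmall : Tendsto (fun n : ℕ => L n / ((n : ℝ) + 1)) atTop (𝓝 0) := by
      have bd : ∀ ε > 0, ∃ M : ℝ, ∀ n : ℕ, 0 < n → n * |L n| ≤ M + ε * n ^ 2 := by
        intro ε hε
        obtain ⟨K, hK⟩ := (Metric.tendsto_atTop.1 hδ) ε hε
        refine ⟨∑ i ∈ Finset.range (K + 2), i * |L i|, ?_⟩
        intro n hn
        induction n with
        | zero => omega
        | succ n ih =>
          by_cases hnK : n + 1 < K + 2
          · have := Finset.single_le_sum (f := fun i : ℕ => (i : ℝ) * |L i|)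
              (fun i _ => by positivity) (Finset.mem_range.2 hnK)
            have h2 : 0 ≤ ε * ((n + 1 : ℕ) : ℝ) ^ 2 := by positivity
            linarith
          · have hn0 : 0 < n := by omega
            have h1 := ih hn0
            have h2 := hK n (by omega)
            rw [Real.dist_eq, sub_zero] at h2
            have hn' : (0 : ℝ) ≤ n := Nat.cast_nonneg n
            have h3 : ((n : ℝ) + 1) * |L (n + 1)| ≤ (n + 1) * ε + n * |L n| := by
              calc ((n : ℝ) + 1) * |L (n + 1)| = |((n : ℝ) + 1) * L (n + 1)| := by
                    rw [abs_mul, abs_of_pos (by positivity : (0 : ℝ) < n + 1)]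
                _ = |(n + 1) * φ (1 - 1 / ((n : ℝ) + 1)) + n * L n| := by rw [Lrec n hn0]
                _ ≤ |(n + 1) * φ (1 - 1 / ((n : ℝ) + 1))| + |n * L n| := abs_add_le _ _
                _ = (n + 1) * |φ (1 - 1 / ((n : ℝ) + 1))| + n * |L n| := by
                    rw [abs_mul, abs_mul, abs_of_pos (by positivity : (0 : ℝ) < n + 1),
                      Nat.abs_cast]
                _ ≤ _ := by gcongr
            push_cast
            nlinarith [mul_nonneg hε.le hn']
      rw [Metric.tendsto_atTop]
      intro ε hε
      obtain ⟨M, hM⟩ := bd (ε / 2) (by positivity)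
      obtain ⟨N, hN⟩ := exists_nat_gt (M / (ε / 2))
      refine ⟨N + 1, fun n hn => ?_⟩
      have h1 := hM n (by omega)
      have hn1 : (N : ℝ) + 1 ≤ n := by exact_mod_cast hn
      have hN0 : (0 : ℝ) ≤ N := Nat.cast_nonneg N
      have hnp : (0 : ℝ) < n := by linarith
      rw [div_lt_iff₀ (by positivity)] at hN
      rw [Real.dist_eq, sub_zero, abs_div, abs_of_pos (by positivity : (0 : ℝ) < n + 1),
        div_lt_iff₀ (by positivity)]
      have h5 : (n : ℝ) * |L n| < n * (ε * (n + 1)) := by nlinarith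
      exact lt_of_mul_lt_mul_left h5 hnp.le
    have Ld : Tendsto (fun n => L (n + 1) - L n) atTop (𝓝 0) := by
      have := hδ.sub Lsmall
      rw [sub_zero] at this
      refine this.congr' ?_
      filter_upwards [eventually_gt_atTop 0] with n hn
      have h := Lrec n hn
      have hn' : (0 : ℝ) < (n : ℝ) + 1 := by positivity
      have e : L (n + 1) = φ (1 - 1 / ((n : ℝ) + 1)) + n * L n / (n + 1) := by
        rw [eq_comm, ← mul_right_inj' hn'.ne', h, mul_add, mul_div_cancel₀ _ hn'.ne']
      rw [e]
      field_simp
      ring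
    have Llog := additive_log L Lmul Ld
    set c := L 2 / Real.log 2 with hc
    have hc0 : 0 ≤ c := div_nonneg (hnn _ (pU 2 (by norm_num))) (Real.log_nonneg (by norm_num))
    have φrat : ∀ m n : ℕ, m ≤ n → 0 < n → φ ((m : ℝ) / n) = c * Real.binEntropy ((m : ℝ) / n) := by
      intro m n hmn hn
      have hn' : (0 : ℝ) < n := by exact_mod_cast hn
      rcases Nat.eq_zero_or_pos m with rfl | hm
      · simp [φ0]
      obtain ⟨k, rfl⟩ := Nat.exists_eq_add_of_le hmn
      rcases Nat.eq_zero_or_pos k with rfl | hk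
      · have : ((m : ℕ) : ℝ) / ((m + 0 : ℕ) : ℝ) = 1 := by
          rw [add_zero]; exact div_self (by positivity)
        rw [this, φ1]; simp
      have h := Lsplit m k hm hk
      rw [Llog _ hn, Llog _ hm, Llog _ hk] at h
      have hm' : (0 : ℝ) < m := by exact_mod_cast hm
      have hk' : (0 : ℝ) < k := by exact_mod_cast hk
      have e1 : 1 - (m : ℝ) / (m + k : ℕ) = (k : ℝ) / (m + k : ℕ) := by
        push_cast; field_simp; ring
      have e2 : (m : ℝ) / (m + k : ℕ) + (k : ℝ) / (m + k : ℕ) = 1 := by linarith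
      rw [Real.binEntropy, e1, Real.log_inv, Real.log_inv, Real.log_div hm'.ne' hn'.ne',
        Real.log_div hk'.ne' hn'.ne']
      linear_combination (-1) * h - c * Real.log ((m + k : ℕ) : ℝ) * e2
    have φeq : ∀ x, 0 ≤ x → x ≤ 1 → φ x = c * Real.binEntropy x := by
      intro x hx0 hx1
      have t : Tendsto (fun n : ℕ => ((⌊x * ((n : ℝ) + 1)⌋₊ : ℕ) : ℝ) / ((n : ℝ) + 1)) atTop (𝓝 x) := by
        have := (tendsto_nat_floor_mul_div_atTop hx0).comp
          (tendsto_atTop_add_const_right atTop (1 : ℝ) tendsto_natCast_atTop_atTop)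
        exact this
      have fl : ∀ n : ℕ, ⌊x * ((n : ℝ) + 1)⌋₊ ≤ n + 1 := by
        intro n
        apply Nat.floor_le_of_le
        push_cast
        nlinarith [(Nat.cast_nonneg n : (0 : ℝ) ≤ n)]
      have t1 := hcont _ x (fun n => by positivity) (fun n => by
        rw [div_le_one (by positivity)]; exact_mod_cast fl n) hx0 hx1 t
      have t2 := ((Real.binEntropy_continuous.tendsto x).comp t).const_mul c
      refine tendsto_nhds_unique t1 (t2.congr fun n => ?_)
      have := φrat _ (n + 1) (fl n) (Nat.succ_pos n)
      push_cast at this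
      exact this.symm
    refine ⟨c, hc0, ?_⟩
    intro X _ p hp
    have sh : ∀ {X : Type} [Fintype X] (p : X → ℝ), tsallis 1 p = ∑ i, Real.negMulLog (p i) := by
      intro X _ p
      simp [tsallis, shannon, Real.negMulLog]
    rw [sh]
    refine prob_induction (fun {X} _ p => I p = c * ∑ i, Real.negMulLog (p i)) ?_ ?_ ?_ p hp
    · change I u = _
      rw [show I u = 0 from hunit]; simp
    · intro X Y _ _ e p hp h
      rw [hinv e p hp, h]
      congr 1
      exact (e.sum_comp (fun i => Real.negMulLog (p i))).symm
    · intro X Y _ _ p q lam h0 h1 hp hq h h'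
      rw [hcv' p q lam h0 h1 hp hq, h, h', φeq lam h0 h1, Fintype.sum_sum_type,
        Real.binEntropy_eq_negMulLog_add_negMulLog_one_sub]
      simp only [cvx, Sum.elim_inl, Sum.elim_inr, Real.negMulLog_mul, Finset.sum_add_distrib,
        ← Finset.mul_sum, ← Finset.sum_mul, hp.2, hq.2]
      ring
  · -- the case `α ≠ 1`
    set b : Unit ⊕ Unit → ℝ := cvx (1 / 2) u u with hb
    have pb : IsProb b := isProb_cvx (by norm_num) (by norm_num) pu pu
    have Sb : ∑ i, b i ^ α = 2 ^ (1 - α) := by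
      rw [hb, S_cvx _ _ _ (by norm_num) (by norm_num) pu pu]
      simp only [hu, Real.one_rpow, Finset.univ_unique, Finset.sum_const, Finset.card_singleton,
        one_smul, mul_one]
      rw [show (1 : ℝ) - 1 / 2 = 1 / 2 by norm_num, Real.rpow_sub (by norm_num), Real.rpow_one,
        Real.div_rpow (by norm_num) (by norm_num), Real.one_rpow]
      ring
    have hcomm : ∀ {X : Type} [Fintype X] (p : X → ℝ), IsProb p →
        I p * (1 - 2 ^ (1 - α)) = I b * (1 - ∑ i, p i ^ α) := by
      intro X _ p hp
      have h1 := hprod b pb p hp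
      have h2 := hprod p hp b pb
      have h3 := hinv (Equiv.prodComm X (Unit ⊕ Unit)) _ (isProb_prodM pb hp)
      have h4 : prodM b p ∘ (Equiv.prodComm X (Unit ⊕ Unit)) = prodM p b := by
        funext x; simp [prodM, mul_comm]
      rw [h4, h1, h2, Sb] at h3
      linarith
    have hα1 : α - 1 ≠ 0 := sub_ne_zero.2 h1
    have hpos : 0 < (α - 1) / (1 - 2 ^ (1 - α)) := by
      rcases lt_or_gt_of_ne h1 with h | h
      · apply div_pos_of_neg_of_neg (by linarith)
        have := Real.one_lt_rpow (by norm_num : (1 : ℝ) < 2) (by linarith : 0 < 1 - α)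
        linarith
      · apply div_pos (by linarith)
        have := Real.rpow_lt_one_of_one_lt_of_neg (by norm_num : (1 : ℝ) < 2)
          (by linarith : 1 - α < 0)
        linarith
    have hne : (1 : ℝ) - 2 ^ (1 - α) ≠ 0 := by
      intro h; rw [h] at hpos; simp at hpos
    refine ⟨I b * ((α - 1) / (1 - 2 ^ (1 - α))), mul_nonneg (hnn b pb) hpos.le, ?_⟩
    intro X _ p hp
    have h := hcomm p hp
    rw [tsallis, if_neg h1]
    have e : I p = I b * (1 - ∑ i, p i ^ α) / (1 - 2 ^ (1 - α)) := by
      rw [← h, mul_div_cancel_right₀ _ hne]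
    rw [e]
    field_simp

/-- Characterization of Tsallis information loss (Theorem 6). -/
theorem stmt14 (α : ℝ) (hα : 0 < α)
    (F : ∀ {X Y : Type} [Fintype X] [Fintype Y], (X → ℝ) → (Y → ℝ) → (X → Y) → ℝ)
    (hnn : ∀ {X Y : Type} [Fintype X] [Fintype Y] (p : X → ℝ) (q : Y → ℝ) (f : X → Y),
      IsProb p → IsProb q → IsMP p q f → 0 ≤ F p q f)
    (hfunc : ∀ {X Y Z : Type} [Fintype X] [Fintype Y] [Fintype Z]
      (p : X → ℝ) (q : Y → ℝ) (r : Z → ℝ) (g : X → Y) (f : Y → Z),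
      IsProb p → IsProb q → IsProb r → IsMP p q g → IsMP q r f →
      F p r (f ∘ g) = F q r f + F p q g)
    (hcvx : ∀ {X X' Y Y' : Type} [Fintype X] [Fintype X'] [Fintype Y] [Fintype Y']
      (p : X → ℝ) (p' : X' → ℝ) (q : Y → ℝ) (q' : Y' → ℝ) (f : X → X') (g : Y → Y')
      (lam : ℝ), 0 ≤ lam → lam ≤ 1 →
      IsProb p → IsProb p' → IsProb q → IsProb q' → IsMP p p' f → IsMP q q' g →
      F (cvx lam p q) (cvx lam p' q') (Sum.map f g)
        = lam ^ α * F p p' f + (1 - lam) ^ α * F q q' g)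
    (hcont : ∀ {X Y : Type} [Fintype X] [Fintype Y]
      (pn : ℕ → X → ℝ) (qn : ℕ → Y → ℝ) (fn : ℕ → X → Y)
      (p : X → ℝ) (q : Y → ℝ) (f : X → Y),
      (∀ n, IsProb (pn n)) → (∀ n, IsProb (qn n)) → (∀ n, IsMP (pn n) (qn n) (fn n)) →
      IsProb p → IsProb q → IsMP p q f →
      (∀ᶠ n in atTop, fn n = f) →
      (∀ i, Tendsto (fun n => pn n i) atTop (𝓝 (p i))) →
      (∀ j, Tendsto (fun n => qn n j) atTop (𝓝 (q j))) →
      Tendsto (fun n => F (pn n) (qn n) (fn n)) atTop (𝓝 (F p q f))) :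
    ∃ c : ℝ, 0 ≤ c ∧ ∀ {X Y : Type} [Fintype X] [Fintype Y]
      (p : X → ℝ) (q : Y → ℝ) (f : X → Y),
      IsProb p → IsProb q → IsMP p q f →
      F p q f = c * (tsallis α p - tsallis α q) := by
  have mpT : ∀ {X : Type} [Fintype X] (p : X → ℝ), IsProb p →
      IsMP p (fun _ : Unit => (1 : ℝ)) (fun _ => ()) := by
    intro X _ p hp j
    simp [hp.2]
  have mpE : ∀ {X Y : Type} [Fintype X] [Fintype Y] (e : X ≃ Y) (p : Y → ℝ),
      IsMP (p ∘ e) p e := by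
    intro X Y _ _ e p j
    have := e.sum_comp (fun i => if i = j then p i else 0)
    simp only [Function.comp]
    rw [this]
    simp
  have Fid : ∀ {X : Type} [Fintype X] (p : X → ℝ), IsProb p → F p p id = 0 := by
    intro X _ p hp
    have mp : IsMP p p (id : X → X) := mpE (Equiv.refl X) p
    have := hfunc p p p id id hp hp hp mp mp
    simp only [Function.comp_id] at this
    linarith
  have FT : ∀ {X Y : Type} [Fintype X] [Fintype Y] (p : X → ℝ) (q : Y → ℝ) (f : X → Y),
      IsProb p → IsProb q → IsMP p q f →
      F p (fun _ : Unit => (1 : ℝ)) (fun _ => ()) =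
        F q (fun _ : Unit => (1 : ℝ)) (fun _ => ()) + F p q f := by
    intro X Y _ _ p q f hp hq hf
    exact hfunc p q _ f (fun _ => ()) hp hq isProb_unit hf (mpT q hq)
  obtain ⟨c, hc, h⟩ := entropy_char α hα
    (fun {X} _ p => F p (fun _ : Unit => (1 : ℝ)) (fun _ => ()))
    (fun p hp => hnn _ _ _ hp isProb_unit (mpT p hp))
    (by
      intro X Y _ _ e p hp
      have hpe := isProb_comp e hp
      have m1 := mpE e p
      have m2 : IsMP p (p ∘ e) e.symm := by
        have := mpE e.symm (p ∘ e)
        have e2 : (p ∘ e) ∘ e.symm = p := by funext i; simp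
        rwa [e2] at this
      have h1 := hnn _ _ _ hpe hp m1
      have h2 := hnn _ _ _ hp hpe m2
      have h3 := FT _ _ _ hpe hp m1
      have h4 := FT _ _ _ hp hpe m2
      linarith)
    (Fid _ isProb_unit)
    (by
      intro X Y _ _ p q lam h0 h1 hp hq
      have h := hcvx p _ q _ _ _ lam h0 h1 hp isProb_unit hq isProb_unit (mpT p hp) (mpT q hq)
      have m : IsMP (cvx lam p q) (cvx lam (fun _ : Unit => (1 : ℝ)) (fun _ : Unit => (1 : ℝ)))
          (Sum.map (fun _ => ()) (fun _ => ())) := by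
        intro j
        rw [Fintype.sum_sum_type]
        rcases j with j | j
        · simp [cvx, ← Finset.mul_sum, hp.2]
        · simp [cvx, ← Finset.mul_sum, hq.2]
      have h2 := FT _ _ _ (isProb_cvx h0 h1 hp hq) (isProb_cvx h0 h1 isProb_unit isProb_unit) m
      rw [h2, h]
      ring)
    (by
      intro x y hx0 hx1 hy0 hy1 ht
      refine hcont _ (fun _ => fun _ => 1) (fun _ => fun _ => ()) _ _ _
        (fun n => isProb_cvx (hx0 n) (hx1 n) isProb_unit isProb_unit) (fun _ => isProb_unit)
        (fun n => mpT _ (isProb_cvx (hx0 n) (hx1 n) isProb_unit isProb_unit))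
        (isProb_cvx hy0 hy1 isProb_unit isProb_unit) isProb_unit
        (mpT _ (isProb_cvx hy0 hy1 isProb_unit isProb_unit)) (Eventually.of_forall fun _ => rfl)
        ?_ (fun _ => tendsto_const_nhds)
      rintro (i | i)
      · simpa [cvx] using ht
      · simpa [cvx] using ht.const_sub 1)
  refine ⟨c, hc, ?_⟩
  intro X Y _ _ p q f hp hq hf
  have h1 := FT p q f hp hq hf
  have h2 := h p hp
  have h3 := h q hq
  rw [h2, h3] at h1
  linarith
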